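/- (Finitary Soundness) Let M be a closed term of Λ⊕^cbv. For every tight typing derivation ⊳ ⊢_w M : 𝔟, there exists k ∈ ℕ such that ‖𝔟‖ ≤ eval_k(M) and w ≤ etime_k(M). -/

import Mathlib

open scoped ENNReal

namespace CbV

/-! ### Terms of the probabilistic call-by-value λ-calculus `Λ⊕^cbv` -/

mutual
inductive Val : Type
  | var : ℕ → Val
  | lam : ℕ → Tm → Val
inductive Tm : Type
  | val : Val → Tm
  | app : Val → Val → Tm
  | choice : Tm → Tm → Tm
  | letin : ℕ → Tm → Tm → Tm
end

-- Substitution of a value for a variable.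
mutual
def substV : Val → ℕ → Val → Val
  | .var y, x, V => if y = x then V else .var y
  | .lam y M, x, V => if y = x then .lam y M else .lam y (substT M x V)
def substT : Tm → ℕ → Val → Tm
  | .val W, x, V => .val (substV W x V)
  | .app W U, x, V => .app (substV W x V) (substV U x V)
  | .choice M N, x, V => .choice (substT M x V) (substT N x V)
  | .letin y N M, x, V => .letin y (substT N x V) (if y = x then M else substT M x V)
end

mutual
def fvV : Val → Finset ℕ
  | .var x => {x}
  | .lam x M => fvT M \ {x}
def fvT : Tm → Finset ℕ
  | .val V => fvV V
  | .app V W => fvV V ∪ fvV W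
  | .choice M N => fvT M ∪ fvT N
  | .letin x N M => fvT N ∪ (fvT M \ {x})
end

def Tm.Closed (M : Tm) : Prop := fvT M = ∅
def Val.Closed (V : Val) : Prop := fvV V = ∅

def Tm.isVal : Tm → Bool
  | .val _ => true
  | _ => false

/-! ### Multidistributions and the operational semantics -/

/-- Multidistributions over terms, represented as finite multisets of scaled terms. -/
abbrev MDist := Multiset (ℚ × Tm)

def scaleM (q : ℚ) (m : MDist) : MDist := m.map fun p => (q * p.1, p.2)

/-- One-step reduction from terms to multidistributions. -/
inductive Step : Tm → MDist → Prop
  | beta (x : ℕ) (M : Tm) (V : Val) :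
      Step (.app (.lam x M) V) {(1, substT M x V)}
  | letval (x : ℕ) (V : Val) (M : Tm) :
      Step (.letin x (.val V) M) {(1, substT M x V)}
  | choice (M N : Tm) : Step (.choice M N) {(1/2, M), (1/2, N)}
  | letstep {N : Tm} {m : MDist} (x : ℕ) (M : Tm) :
      Step N m → Step (.letin x N M) (m.map fun p => (p.1, Tm.letin x p.2 M))

/-- Lifting of one-step reduction to multidistributions. -/
inductive Lift : MDist → MDist → Prop
  | value (V : Val) : Lift {(1, Tm.val V)} {(1, Tm.val V)}
  | single {M : Tm} {m : MDist} : Step M m → Lift {(1, M)} m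
  | multi (s : Multiset (ℚ × Tm × MDist)) :
      (∀ x ∈ s, Lift {(1, x.2.1)} x.2.2) →
      Lift (s.map fun x => (x.1, x.2.1)) ((s.map fun x => scaleM x.1 x.2.2).sum)

/-- Functional presentation of one-step reduction (values, and stuck open
terms, are kept unchanged); it agrees with `Step` on closed non-value terms. -/
def stepF : Tm → MDist
  | .val V => {(1, .val V)}
  | .app (.lam x M) W => {(1, substT M x W)}
  | .app (.var y) W => {(1, .app (.var y) W)}
  | .choice M N => {(1/2, M), (1/2, N)}
  | .letin x (.val V) M => {(1, substT M x V)}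
  | .letin x N M => (stepF N).map fun p => (p.1, Tm.letin x p.2 M)

def mstepF (m : MDist) : MDist := (m.map fun p => scaleM p.1 (stepF p.2)).sum

/-- The unique reduction sequence `[M] = 𝔪₀ ⇛ 𝔪₁ ⇛ …` of a closed term. -/
def traj (M : Tm) (k : ℕ) : MDist := mstepF^[k] {(1, M)}

/-- `‖𝔪‖𝒱`: the probability that `𝔪` is a value. -/
def normV (m : MDist) : ℚ := ((m.filter fun p => p.2.isVal = true).map Prod.fst).sum

/-- `eval_k(M)`: the probability that `M` terminates within `k` steps. -/
def evalP (k : ℕ) (M : Tm) : ℚ := normV (traj M k)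

/-- `ProbTerm(M) = sup_k eval_k(M)`. -/
noncomputable def ProbTerm (M : Tm) : ℝ := ⨆ k : ℕ, ((evalP k M : ℚ) : ℝ)

/-- `etime_n(M) = Σ_{k<n} (1 - eval_k(M))`. -/
def etime (n : ℕ) (M : Tm) : ℚ := ∑ k ∈ Finset.range n, (1 - evalP k M)

/-- `ETime(M) = Σ_{k≥0} (1 - eval_k(M)) ∈ [0,∞]`, the expected runtime. -/
noncomputable def ETime (M : Tm) : ℝ≥0∞ :=
  ∑' k : ℕ, ENNReal.ofReal ((1 : ℝ) - ((evalP k M : ℚ) : ℝ))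

/-! ### Non-idempotent monadic intersection types -/

/-- Arrow types `𝖠 ::= 𝒜 → 𝔞`, where `𝒜` is an intersection type
(a finite multiset of scaled arrow types, represented as a list) and `𝔞`
is a type distribution (a multidistribution of intersection types,
represented as a list). -/
inductive ATy : Type
  | arr : List (ℚ × ATy) → List (ℚ × List (ℚ × ATy)) → ATy

/-- Intersection types. -/
abbrev ITy := List (ℚ × ATy)
/-- Type distributions. -/
abbrev DTy := List (ℚ × ITy)

/-- A type of any of the three kinds. -/
inductive Ty : Type
  | arrow : ATy → Ty
  | inter : ITy → Ty
  | dist : DTy → Ty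

/-- Typing contexts. -/
abbrev Ctx := ℕ → ITy

def emptyCtx : Ctx := fun _ => []

def scaleL {α : Type} (q : ℚ) (l : List (ℚ × α)) : List (ℚ × α) :=
  l.map fun p => (q * p.1, p.2)

def ctxUnion (Γ Δ : Ctx) : Ctx := fun x => Γ x ++ Δ x

/-- A type distribution is tight if every intersection type in it is empty. -/
def Tight (a : DTy) : Prop := ∀ p ∈ a, p.2 = ([] : ITy)

/-- `‖𝔞‖`: the sum of the probabilities occurring in a type distribution. -/
def normD (a : DTy) : ℚ := (a.map Prod.fst).sum

/-- Typing derivations `Π ⊳ Γ ⊢_w M : σ`. -/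
inductive Deriv : Ctx → ℚ → Tm → Ty → Type
  | var (x : ℕ) (A : ITy) :
      Deriv (Function.update emptyCtx x A) 0 (.val (.var x)) (.inter A)
  | zero (M : Tm) : Deriv emptyCtx 0 M (.dist [])
  | lam {Γ : Ctx} {w : ℚ} {M : Tm} (x : ℕ) (b : DTy) :
      Deriv Γ w M (.dist b) →
      Deriv (Function.update Γ x []) (w + 1) (.val (.lam x M)) (.arrow (.arr (Γ x) b))
  | app {Γ Δ : Ctx} {w v : ℚ} {V W : Val} {A : ITy} {b : DTy} :
      Deriv Γ w (.val V) (.inter [(1, .arr A b)]) →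
      Deriv Δ v (.val W) (.inter A) →
      Deriv (ctxUnion Γ Δ) (w + v) (.app V W) (.dist b)
  | choice {Γ Δ : Ctx} {w v : ℚ} {M N : Tm} {a b : DTy} :
      Deriv Γ w M (.dist a) → Deriv Δ v N (.dist b) →
      Deriv (ctxUnion (fun y => scaleL (1/2) (Γ y)) (fun y => scaleL (1/2) (Δ y)))
        (w / 2 + v / 2 + 1) (.choice M N)
        (.dist (scaleL (1/2) a ++ scaleL (1/2) b))
  | letin {Γ : Ctx} {v : ℚ} (x : ℕ) {N M : Tm}
      (K : List (ℚ × ITy × Ctx × ℚ × DTy)) :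
      (∀ k ∈ K, k.2.2.1 x = []) →
      ((i : Fin K.length) →
        Deriv (Function.update (K.get i).2.2.1 x (K.get i).2.1)
          (K.get i).2.2.2.1 M (.dist (K.get i).2.2.2.2)) →
      Deriv Γ v N (.dist (K.map fun k => (k.1, k.2.1))) →
      Deriv (ctxUnion Γ (fun y => (K.map fun k => scaleL k.1 (k.2.2.1 y)).flatten))
        ((K.map fun k => k.1 * k.2.2.2.1).sum + v + 1)
        (.letin x N M)
        (.dist (K.map fun k => scaleL k.1 k.2.2.2.2).flatten)
  | tval {Γ : Ctx} {w : ℚ} {V : Val} {A : ITy} :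
      Deriv Γ w (.val V) (.inter A) → Deriv Γ w (.val V) (.dist [(1, A)])
  | bang {V : Val} (I : List (ℚ × Ctx × ℚ × ATy)) :
      (∀ k ∈ I, 0 < k.1 ∧ k.1 ≤ 1) →
      ((i : Fin I.length) →
        Deriv (I.get i).2.1 (I.get i).2.2.1 (.val V) (.arrow (I.get i).2.2.2)) →
      Deriv (fun y => (I.map fun k => scaleL k.1 (k.2.1 y)).flatten)
        ((I.map fun k => k.1 * k.2.2.1).sum) (.val V)
        (.inter (I.map fun k => (k.1, k.2.2.2)))

/-- Size of a derivation: the number of rules, excluding `!` and `Val`. -/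
def Deriv.size : ∀ {Γ : Ctx} {w : ℚ} {M : Tm} {τ : Ty}, Deriv Γ w M τ → ℕ
  | _, _, _, _, .var _ _ => 1
  | _, _, _, _, .zero _ => 1
  | _, _, _, _, .lam _ _ d => d.size + 1
  | _, _, _, _, .app d e => d.size + e.size + 1
  | _, _, _, _, .choice d e => d.size + e.size + 1
  | _, _, _, _, .letin _ _ _ f d => d.size + (List.ofFn fun i => (f i).size).sum + 1
  | _, _, _, _, .tval d => d.size
  | _, _, _, _, .bang _ _ f => (List.ofFn fun i => (f i).size).sum


/-! ### Finitary big-step evaluation -/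

/-- Finitary big-step evaluation with ordered list of values and cost. -/
inductive Big : Tm → List (ℚ × Val) → ℚ → Prop
  | zero (M : Tm) : Big M [] 0
  | val (V : Val) : Big (.val V) [(1, V)] 0
  | beta {x : ℕ} {M : Tm} {V : Val} {l : List (ℚ × Val)} {c : ℚ} :
      Big (substT M x V) l c → Big (.app (.lam x M) V) l (c + 1)
  | choice {M N : Tm} {l l' : List (ℚ × Val)} {c c' : ℚ} :
      Big M l c → Big N l' c' →
      Big (.choice M N) (scaleL (1/2) l ++ scaleL (1/2) l') (c / 2 + c' / 2 + 1)
  | letin {x : ℕ} {N M : Tm} {n : ℕ} (p : Fin n → ℚ) (V : Fin n → Val)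
      (l : Fin n → List (ℚ × Val)) (c : Fin n → ℚ) {d : ℚ} :
      Big N (List.ofFn fun i => (p i, V i)) d →
      (∀ i, Big (substT M x (V i)) (l i) (c i)) →
      Big (.letin x N M) (List.ofFn fun i => scaleL (p i) (l i)).flatten
        (∑ i, p i * c i + d + 1)

/-! ### The logical relation -/

mutual
def ARel : ATy → Val → ℚ → Prop
  | .arr A b, V, w => ∀ (W : Val) (v : ℚ), W.Closed → IRel A W v →
      ∃ l c u, Big (.app V W) l c ∧ DMatch b l u ∧ w + v = c + u
def IRel : List (ℚ × ATy) → Val → ℚ → Prop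
  | [], _, w => w = 0
  | (q, a) :: l, V, w => ∃ w1 w2, w = q * w1 + w2 ∧ ARel a V w1 ∧ IRel l V w2
def DMatch : List (ℚ × List (ℚ × ATy)) → List (ℚ × Val) → ℚ → Prop
  | [], l, u => l = [] ∧ u = 0
  | (p, B) :: b, l, u => ∃ V v l' u', l = (p, V) :: l' ∧ u = p * v + u' ∧ V.Closed ∧
      IRel B V v ∧ DMatch b l' u'
end

def DRel (b : DTy) (M : Tm) (w : ℚ) : Prop :=
  ∃ l c u, Big M l c ∧ DMatch b l u ∧ w = c + u

def Rel : Ty → Tm → ℚ → Prop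
  | .arrow a, t, w => ∃ V, t = .val V ∧ ARel a V w
  | .inter A, t, w => ∃ V, t = .val V ∧ IRel A V w
  | .dist b, t, w => DRel b t w

theorem IRel_nil {V : Val} {w : ℚ} : IRel [] V w ↔ w = 0 := by rw [IRel]

theorem IRel_cons {q a l} {V : Val} {w : ℚ} : IRel ((q, a) :: l) V w ↔
    ∃ w1 w2, w = q * w1 + w2 ∧ ARel a V w1 ∧ IRel l V w2 := by rw [IRel]

theorem DMatch_nil {l u} : DMatch [] l u ↔ l = [] ∧ u = 0 := by rw [DMatch]

theorem DMatch_cons {p B b l u} : DMatch ((p, B) :: b) l u ↔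
    ∃ V v l' u', l = (p, V) :: l' ∧ u = p * v + u' ∧ V.Closed ∧
      IRel B V v ∧ DMatch b l' u' := by rw [DMatch]

theorem IRel_append {A B : ITy} {V : Val} : ∀ {w : ℚ}, IRel (A ++ B) V w →
    ∃ w1 w2, w = w1 + w2 ∧ IRel A V w1 ∧ IRel B V w2 := by
  induction A with
  | nil => intro w h; exact ⟨0, w, by simp, IRel_nil.2 rfl, h⟩
  | cons a A ih =>
    intro w h
    obtain ⟨q, a⟩ := a
    rw [List.cons_append, IRel_cons] at h
    obtain ⟨w1, w2, rfl, h1, h2⟩ := h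
    obtain ⟨w3, w4, rfl, h3, h4⟩ := ih h2
    exact ⟨q * w1 + w3, w4, by ring, IRel_cons.2 ⟨_, _, rfl, h1, h3⟩, h4⟩

theorem IRel_scale {A : ITy} {V : Val} {q : ℚ} : ∀ {w : ℚ}, IRel (scaleL q A) V w →
    ∃ w1, w = q * w1 ∧ IRel A V w1 := by
  induction A with
  | nil => intro w h; exact ⟨0, by simpa [scaleL, IRel_nil] using h, IRel_nil.2 rfl⟩
  | cons a A ih =>
    intro w h
    obtain ⟨r, a⟩ := a
    rw [scaleL, List.map_cons, IRel_cons] at h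
    obtain ⟨w1, w2, rfl, h1, h2⟩ := h
    obtain ⟨w3, rfl, h3⟩ := ih h2
    exact ⟨r * w1 + w3, by ring, IRel_cons.2 ⟨_, _, rfl, h1, h3⟩⟩

theorem IRel_flatten {α : Type} {V : Val} (p : α → ℚ) (f : α → ITy) (K : List α) :
    ∀ {w : ℚ}, IRel ((K.map fun k => scaleL (p k) (f k)).flatten) V w →
    ∃ g : Fin K.length → ℚ, w = ∑ i, p (K.get i) * g i ∧ ∀ i, IRel (f (K.get i)) V (g i) := by
  induction K with
  | nil => intro w h; exact ⟨fun _ => 0, by simpa [IRel_nil] using h, fun i => i.elim0⟩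
  | cons a K ih =>
    intro w h
    rw [List.map_cons, List.flatten_cons] at h
    obtain ⟨w1, w2, rfl, h1, h2⟩ := IRel_append h
    obtain ⟨w3, rfl, h3⟩ := IRel_scale h1
    obtain ⟨g, rfl, hg⟩ := ih h2
    refine ⟨Fin.cons w3 g, ?_, ?_⟩
    · simp [Fin.sum_univ_succ]
    · intro i
      refine Fin.cases ?_ (fun j => ?_) i
      · simpa using h3
      · simpa using hg j

theorem DMatch_append {a b : DTy} : ∀ {l l' : List (ℚ × Val)} {u u' : ℚ}, DMatch a l u →
    DMatch b l' u' → DMatch (a ++ b) (l ++ l') (u + u') := by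
  induction a with
  | nil => intro l l' u u' h h'; obtain ⟨rfl, rfl⟩ := DMatch_nil.1 h; simpa using h'
  | cons a A ih =>
    intro l l' u u' h h'
    obtain ⟨q, a⟩ := a
    obtain ⟨V, v, l1, u1, rfl, rfl, h1, h2, h3⟩ := DMatch_cons.1 h
    exact DMatch_cons.2 ⟨V, v, l1 ++ l', u1 + u', rfl, by ring, h1, h2, ih h3 h'⟩

theorem DMatch_scale {a : DTy} {q : ℚ} : ∀ {l : List (ℚ × Val)} {u : ℚ}, DMatch a l u →
    DMatch (scaleL q a) (scaleL q l) (q * u) := by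
  induction a with
  | nil => intro l u h; obtain ⟨rfl, rfl⟩ := DMatch_nil.1 h; simp [scaleL, DMatch_nil]
  | cons a A ih =>
    intro l u h
    obtain ⟨r, a⟩ := a
    obtain ⟨V, v, l1, u1, rfl, rfl, h1, h2, h3⟩ := DMatch_cons.1 h
    exact DMatch_cons.2 ⟨V, v, scaleL q l1, q * u1, rfl, by ring, h1, h2, ih h3⟩

theorem DMatch_flatten {α : Type} (p : α → ℚ) (f : α → DTy) (K : List α) :
    ∀ (l : Fin K.length → List (ℚ × Val)) (u : Fin K.length → ℚ),
    (∀ i, DMatch (f (K.get i)) (l i) (u i)) →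
    DMatch ((K.map fun k => scaleL (p k) (f k)).flatten)
      (List.ofFn fun i => scaleL (p (K.get i)) (l i)).flatten (∑ i, p (K.get i) * u i) := by
  induction K with
  | nil => intro l u h; simp [DMatch_nil]
  | cons a K ih =>
    intro l u h
    have h1 := ih (fun i => l i.succ) (fun i => u i.succ) (fun i => by simpa using h i.succ)
    have h0 : DMatch (f a) (l 0) (u 0) := by simpa using h 0
    have := DMatch_append (DMatch_scale (q := p a) h0) h1
    simpa [Fin.sum_univ_succ, List.ofFn_succ] using this

theorem DMatch_map {α : Type} (p : α → ℚ) (f : α → ITy) (K : List α) :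
    ∀ {l : List (ℚ × Val)} {u : ℚ}, DMatch (K.map fun k => (p k, f k)) l u →
    ∃ (V : Fin K.length → Val) (v : Fin K.length → ℚ),
      l = (List.ofFn fun i => (p (K.get i), V i)) ∧ u = ∑ i, p (K.get i) * v i ∧
      (∀ i, (V i).Closed) ∧ ∀ i, IRel (f (K.get i)) (V i) (v i) := by
  induction K with
  | nil =>
    intro l u h
    obtain ⟨rfl, rfl⟩ := DMatch_nil.1 h
    exact ⟨fun i => i.elim0, fun i => i.elim0, by simp, by simp, fun i => i.elim0,
      fun i => i.elim0⟩
  | cons a K ih =>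
    intro l u h
    obtain ⟨V, v, l1, u1, rfl, rfl, h1, h2, h3⟩ := DMatch_cons.1 h
    obtain ⟨Vs, vs, rfl, rfl, h4, h5⟩ := ih h3
    refine ⟨Fin.cons V Vs, Fin.cons v vs, ?_, ?_, ?_, ?_⟩
    · simp [List.ofFn_succ]
    · simp [Fin.sum_univ_succ]
    · exact fun i => Fin.cases (by simpa using h1) (fun j => by simpa using h4 j) i
    · exact fun i => Fin.cases (by simpa using h2) (fun j => by simpa using h5 j) i

theorem IRel_bang {α : Type} {V : Val} (p : α → ℚ) (f : α → ATy) (K : List α) :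
    ∀ (u : Fin K.length → ℚ), (∀ i, ARel (f (K.get i)) V (u i)) →
    IRel (K.map fun k => (p k, f k)) V (∑ i, p (K.get i) * u i) := by
  induction K with
  | nil => intro u h; simp [IRel_nil]
  | cons a K ih =>
    intro u h
    have h1 := ih (fun i => u i.succ) (fun i => by simpa using h i.succ)
    have h0 : ARel (f a) V (u 0) := by simpa using h 0
    exact IRel_cons.2 ⟨_, _, by simp [Fin.sum_univ_succ], h0, h1⟩

theorem sum_map_get {α : Type} (K : List α) (f : α → ℚ) :
    (K.map f).sum = ∑ i, f (K.get i) := by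
  induction K with
  | nil => simp
  | cons a K ih =>
    rw [List.map_cons, List.sum_cons, ih]
    simp [Fin.sum_univ_succ]

/-! ### Simultaneous substitution -/

mutual
def msubV (ρ : ℕ → Val) : Val → Val
  | .var y => ρ y
  | .lam y M => .lam y (msubT (Function.update ρ y (.var y)) M)
def msubT (ρ : ℕ → Val) : Tm → Tm
  | .val W => .val (msubV ρ W)
  | .app W U => .app (msubV ρ W) (msubV ρ U)
  | .choice M N => .choice (msubT ρ M) (msubT ρ N)
  | .letin y N M => .letin y (msubT ρ N) (msubT (Function.update ρ y (.var y)) M)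
end

def OKEnv (ρ : ℕ → Val) : Prop := ∀ y, (ρ y).Closed ∨ ρ y = .var y

theorem OKEnv.upd {ρ : ℕ → Val} (h : OKEnv ρ) (x : ℕ) :
    OKEnv (Function.update ρ x (.var x)) := by
  intro y
  by_cases hy : y = x
  · subst hy; right; simp
  · simpa [Function.update_of_ne hy] using h y

theorem OKEnv.updC {ρ : ℕ → Val} (h : OKEnv ρ) (x : ℕ) {W : Val} (hW : W.Closed) :
    OKEnv (Function.update ρ x W) := by
  intro y
  by_cases hy : y = x
  · subst hy; left; simpa using hW
  · simpa [Function.update_of_ne hy] using h y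

mutual
theorem substV_fresh : ∀ (V : Val) (x : ℕ) (W : Val), x ∉ fvV V → substV V x W = V
  | .var y, x, W, h => by
    simp only [fvV, Finset.mem_singleton] at h
    simp [substV, Ne.symm h]
  | .lam y M, x, W, h => by
    rw [substV]
    split_ifs with hy
    · rfl
    · rw [substT_fresh M x W]
      simp only [fvV, Finset.mem_sdiff, Finset.mem_singleton, not_and, not_not] at h
      exact fun hx => hy (h hx).symm
theorem substT_fresh : ∀ (M : Tm) (x : ℕ) (W : Val), x ∉ fvT M → substT M x W = M
  | .val V, x, W, h => by
    rw [substT, substV_fresh V x W (by simpa [fvT] using h)]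
  | .app V U, x, W, h => by
    simp only [fvT, Finset.mem_union, not_or] at h
    rw [substT, substV_fresh V x W h.1, substV_fresh U x W h.2]
  | .choice M N, x, W, h => by
    simp only [fvT, Finset.mem_union, not_or] at h
    rw [substT, substT_fresh M x W h.1, substT_fresh N x W h.2]
  | .letin y N M, x, W, h => by
    simp only [fvT, Finset.mem_union, not_or, Finset.mem_sdiff, Finset.mem_singleton,
      not_and, not_not] at h
    rw [substT, substT_fresh N x W h.1]
    split_ifs with hy
    · rfl
    · rw [substT_fresh M x W (fun hx => hy (h.2 hx).symm)]
end

mutual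
theorem msubV_var : ∀ (V : Val), msubV Val.var V = V
  | .var y => by rw [msubV]
  | .lam y M => by
    rw [msubV, Function.update_eq_self, msubT_var M]
theorem msubT_var : ∀ (M : Tm), msubT Val.var M = M
  | .val V => by rw [msubT, msubV_var V]
  | .app V U => by rw [msubT, msubV_var V, msubV_var U]
  | .choice M N => by rw [msubT, msubT_var M, msubT_var N]
  | .letin y N M => by rw [msubT, Function.update_eq_self, msubT_var M, msubT_var N]
end

mutual
theorem subst_msubV : ∀ (V : Val) (ρ : ℕ → Val) (x : ℕ) (W : Val), OKEnv ρ →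
    substV (msubV (Function.update ρ x (.var x)) V) x W = msubV (Function.update ρ x W) V
  | .var y, ρ, x, W, h => by
    rw [msubV, msubV]
    by_cases hy : y = x
    · subst hy; simp [substV]
    · rw [Function.update_of_ne hy, Function.update_of_ne hy]
      rcases h y with h | h
      · exact substV_fresh _ _ _ (by rw [Val.Closed] at h; simp [h])
      · rw [h]; simp [substV, hy]
  | .lam y M, ρ, x, W, h => by
    rw [msubV, msubV, substV]
    split_ifs with hy
    · subst hy; simp
    · rw [Function.update_comm (Ne.symm hy), Function.update_comm (Ne.symm hy),
        subst_msubT M _ x W (h.upd y)]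
theorem subst_msubT : ∀ (M : Tm) (ρ : ℕ → Val) (x : ℕ) (W : Val), OKEnv ρ →
    substT (msubT (Function.update ρ x (.var x)) M) x W = msubT (Function.update ρ x W) M
  | .val V, ρ, x, W, h => by
    rw [msubT, msubT, substT, subst_msubV V ρ x W h]
  | .app V U, ρ, x, W, h => by
    rw [msubT, msubT, substT, subst_msubV V ρ x W h, subst_msubV U ρ x W h]
  | .choice M N, ρ, x, W, h => by
    rw [msubT, msubT, substT, subst_msubT M ρ x W h, subst_msubT N ρ x W h]
  | .letin y N M, ρ, x, W, h => by
    rw [msubT, msubT, substT, subst_msubT N ρ x W h]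
    split_ifs with hy
    · subst hy; simp
    · rw [Function.update_comm (Ne.symm hy), Function.update_comm (Ne.symm hy),
        subst_msubT M _ x W (h.upd y)]
end

mutual
theorem fv_msubV : ∀ (V : Val) (ρ : ℕ → Val) (z : ℕ), z ∈ fvV (msubV ρ V) →
    ∃ y ∈ fvV V, z ∈ fvV (ρ y)
  | .var y, ρ, z, h => ⟨y, by simp [fvV], by simpa [msubV] using h⟩
  | .lam x M, ρ, z, h => by
    simp only [msubV, fvV, Finset.mem_sdiff, Finset.mem_singleton] at h
    obtain ⟨y, hy, hz⟩ := fv_msubT M _ z h.1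
    by_cases hxy : y = x
    · subst hxy; simp [fvV, h.2] at hz
    · rw [Function.update_of_ne hxy] at hz
      exact ⟨y, by simp [fvV, hy, hxy], hz⟩
theorem fv_msubT : ∀ (M : Tm) (ρ : ℕ → Val) (z : ℕ), z ∈ fvT (msubT ρ M) →
    ∃ y ∈ fvT M, z ∈ fvV (ρ y)
  | .val V, ρ, z, h => by
    simp only [msubT, fvT] at h ⊢
    exact fv_msubV V ρ z h
  | .app V U, ρ, z, h => by
    simp only [msubT, fvT, Finset.mem_union] at h ⊢
    rcases h with h | h
    · obtain ⟨y, hy, hz⟩ := fv_msubV V _ z h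
      exact ⟨y, Or.inl hy, hz⟩
    · obtain ⟨y, hy, hz⟩ := fv_msubV U _ z h
      exact ⟨y, Or.inr hy, hz⟩
  | .choice M N, ρ, z, h => by
    simp only [msubT, fvT, Finset.mem_union] at h ⊢
    rcases h with h | h
    · obtain ⟨y, hy, hz⟩ := fv_msubT M _ z h
      exact ⟨y, Or.inl hy, hz⟩
    · obtain ⟨y, hy, hz⟩ := fv_msubT N _ z h
      exact ⟨y, Or.inr hy, hz⟩
  | .letin x N M, ρ, z, h => by
    simp only [msubT, fvT, Finset.mem_union, Finset.mem_sdiff, Finset.mem_singleton] at h ⊢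
    rcases h with h | ⟨h, hzx⟩
    · obtain ⟨y, hy, hz⟩ := fv_msubT N _ z h
      exact ⟨y, Or.inl hy, hz⟩
    · obtain ⟨y, hy, hz⟩ := fv_msubT M _ z h
      by_cases hxy : y = x
      · subst hxy; simp [fvV, hzx] at hz
      · rw [Function.update_of_ne hxy] at hz
        exact ⟨y, Or.inr ⟨hy, hxy⟩, hz⟩
end

theorem closed_msubV {V : Val} {ρ : ℕ → Val} (h : ∀ y ∈ fvV V, (ρ y).Closed) :
    (msubV ρ V).Closed := by
  rw [Val.Closed, Finset.eq_empty_iff_forall_notMem]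
  intro z hz
  obtain ⟨y, hy, hz⟩ := fv_msubV V ρ z hz
  have := h y hy
  rw [Val.Closed] at this
  simp [this] at hz

/-! ### Soundness of typing for the logical relation -/

theorem sum_upd {S : Finset ℕ} {v : ℕ → ℚ} {x : ℕ} {u : ℚ} (hv : v x = 0) :
    ∑ y ∈ insert x S, Function.update v x u y = u + ∑ y ∈ S, v y := by
  rw [← Finset.sum_erase S hv, ← Finset.insert_erase (Finset.mem_insert_self x S),
    Finset.sum_insert (Finset.notMem_erase _ _), Finset.erase_insert_eq_erase]
  simp only [Function.update_self]
  congr 1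
  refine Finset.sum_congr rfl fun y hy => ?_
  rw [Function.update_of_ne (Finset.ne_of_mem_erase hy)]

theorem sound {Γ : Ctx} {w : ℚ} {M : Tm} {τ : Ty} (D : Deriv Γ w M τ) :
    ∀ (S : Finset ℕ) (ρ : ℕ → Val) (v : ℕ → ℚ), (∀ y ∈ fvT M, (ρ y).Closed) → OKEnv ρ →
      (∀ y, y ∉ S → Γ y = []) → (∀ y, IRel (Γ y) (ρ y) (v y)) →
      Rel τ (msubT ρ M) (w + ∑ y ∈ S, v y) := by
  induction D with
  | var x A =>
    intro S ρ v hc ho hS hv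
    refine ⟨ρ x, by simp [msubT, msubV], ?_⟩
    have h0 : ∀ y, y ≠ x → v y = 0 := by
      intro y hy
      have := hv y
      rw [Function.update_of_ne hy] at this
      exact IRel_nil.1 this
    have hx := hv x
    have : ∑ y ∈ S, v y = v x := by
      refine Finset.sum_eq_single x (fun y _ hy => h0 y hy) ?_
      intro hxS
      have h1 := hS x hxS
      rw [h1] at hx
      exact IRel_nil.1 hx
    rw [Function.update_self] at hx
    rw [this, zero_add]
    exact hx
  | zero M =>
    intro S ρ v hc ho hS hv
    refine ⟨[], 0, 0, .zero _, DMatch_nil.2 ⟨rfl, rfl⟩, ?_⟩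
    rw [Finset.sum_eq_zero fun y _ => IRel_nil.1 (hv y)]
  | @lam Γ w M x b D ih =>
    intro S ρ v hc ho hS hv
    refine ⟨_, by rw [msubT, msubV], ?_⟩
    rw [ARel]
    intro W u hW hu
    have hvx : v x = 0 := by
      have := hv x
      rw [Function.update_self] at this
      exact IRel_nil.1 this
    have key := ih (insert x S) (Function.update ρ x W) (Function.update v x u) ?_
      (ho.updC x hW) ?_ ?_
    · obtain ⟨l, c, e, h1, h2, h3⟩ := key
      rw [sum_upd hvx] at h3
      rw [← subst_msubT _ _ _ _ ho] at h1
      exact ⟨l, c + 1, e, .beta h1, h2, by linarith⟩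
    · intro y hy
      by_cases hyx : y = x
      · subst hyx; simpa using hW
      · rw [Function.update_of_ne hyx]
        exact hc y (by simp [fvT, fvV, hy, hyx])
    · intro y hy
      simp only [Finset.mem_insert, not_or] at hy
      have := hS y hy.2
      rwa [Function.update_of_ne hy.1] at this
    · intro y
      by_cases hyx : y = x
      · subst hyx; simpa using hu
      · have := hv y
        rw [Function.update_of_ne hyx] at this
        rw [Function.update_of_ne hyx, Function.update_of_ne hyx]
        exact this
  | @app Γ Δ w v0 V W A b D1 D2 ih1 ih2 =>
    intro S ρ v hc ho hS hv
    choose v1 v2 h12 h1 h2 using fun y => IRel_append (hv y)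
    simp only [fvT, Finset.mem_union] at hc
    obtain ⟨V', e1, r1⟩ := ih1 S ρ v1 (fun y hy => hc y (Or.inl (by simpa [fvT] using hy))) ho
      (fun y hy => (List.append_eq_nil_iff.1 (hS y hy)).1) h1
    obtain ⟨W', e2, r2⟩ := ih2 S ρ v2 (fun y hy => hc y (Or.inr (by simpa [fvT] using hy))) ho
      (fun y hy => (List.append_eq_nil_iff.1 (hS y hy)).2) h2
    simp only [msubT, Tm.val.injEq] at e1 e2
    obtain ⟨a1, a2, ha, r1, r0⟩ := IRel_cons.1 r1
    rw [IRel_nil] at r0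
    rw [ARel] at r1
    obtain ⟨l, c, u, g1, g2, g3⟩ := r1 W' _
      (e2 ▸ closed_msubV (fun y hy => hc y (Or.inr hy))) r2
    refine ⟨l, c, u, ?_, g2, ?_⟩
    · rw [msubT, e1, e2]; exact g1
    · simp only [h12, Finset.sum_add_distrib]
      linarith
  | @choice Γ Δ w v0 M N a b D1 D2 ih1 ih2 =>
    intro S ρ v hc ho hS hv
    choose v1 v2 h12 h1 h2 using fun y => IRel_append (hv y)
    choose v1' e1 h1' using fun y => IRel_scale (h1 y)
    choose v2' e2 h2' using fun y => IRel_scale (h2 y)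
    simp only [fvT, Finset.mem_union] at hc
    obtain ⟨l, c, u, g1, g2, g3⟩ := ih1 S ρ v1' (fun y hy => hc y (Or.inl hy)) ho
      (fun y hy => List.map_eq_nil_iff.1 (List.append_eq_nil_iff.1 (hS y hy)).1) h1'
    obtain ⟨l', c', u', g1', g2', g3'⟩ := ih2 S ρ v2' (fun y hy => hc y (Or.inr hy)) ho
      (fun y hy => List.map_eq_nil_iff.1 (List.append_eq_nil_iff.1 (hS y hy)).2) h2'
    refine ⟨_, c / 2 + c' / 2 + 1, _, ?_,
      DMatch_append (DMatch_scale g2) (DMatch_scale g2'), ?_⟩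
    · rw [msubT]; exact .choice g1 g1'
    · simp only [h12, e1, e2, Finset.sum_add_distrib, ← Finset.mul_sum]
      linarith
  | @letin Γ v0 x N M K hK f D ihf ih =>
    intro S ρ v hc ho hS hv
    choose v1 v2 h12 h1 h2 using fun y => IRel_append (hv y)
    simp only [fvT, Finset.mem_union, Finset.mem_sdiff, Finset.mem_singleton] at hc
    obtain ⟨l, c, u, g1, g2, g3⟩ := ih S ρ v1 (fun y hy => hc y (Or.inl hy)) ho
      (fun y hy => (List.append_eq_nil_iff.1 (hS y hy)).1) h1
    obtain ⟨V, t, rfl, rfl, hV, hR⟩ := DMatch_map _ _ K g2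
    choose g eg hg using fun y => IRel_flatten (fun k : ℚ × ITy × Ctx × ℚ × DTy => k.1)
      (fun k => k.2.2.1 y) K (h2 y)
    have key : ∀ i : Fin K.length, DRel (K.get i).2.2.2.2
        (substT (msubT (Function.update ρ x (.var x)) M) x (V i))
        ((K.get i).2.2.2.1 + (t i + ∑ y ∈ S, g y i)) := by
      intro i
      have hgx : g x i = 0 := by
        have := hg x i
        rw [hK _ (List.get_mem K i)] at this
        exact IRel_nil.1 this
      have := ihf i (insert x S) (Function.update ρ x (V i))
        (Function.update (fun y => g y i) x (t i)) ?_ (ho.updC x (hV i)) ?_ ?_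
      · rw [sum_upd (v := fun y => g y i) hgx] at this
        rw [subst_msubT _ _ _ _ ho]
        exact this
      · intro y hy
        by_cases hyx : y = x
        · subst hyx; simpa using hV i
        · rw [Function.update_of_ne hyx]
          exact hc y (Or.inr ⟨hy, hyx⟩)
      · intro y hy
        simp only [Finset.mem_insert, not_or] at hy
        have := (List.append_eq_nil_iff.1 (hS y hy.2)).2
        rw [List.flatten_eq_nil_iff] at this
        rw [Function.update_of_ne hy.1]
        exact List.map_eq_nil_iff.1 (this _ (List.mem_map_of_mem (List.get_mem K i)))
      · intro y
        by_cases hyx : y = x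
        · subst hyx; simpa using hR i
        · rw [Function.update_of_ne hyx, Function.update_of_ne hyx,
            Function.update_of_ne hyx]
          exact hg y i
    choose l' c' u' k1 k2 k3 using key
    refine ⟨_, ∑ i, (K.get i).1 * c' i + c + 1, _, ?_,
      DMatch_flatten (fun k : ℚ × ITy × Ctx × ℚ × DTy => k.1) _ K l' u' k2, ?_⟩
    · rw [msubT]; exact .letin _ V l' c' g1 k1
    · simp only [h12, eg, Finset.sum_add_distrib]
      rw [Finset.sum_comm, sum_map_get]
      have e : ∀ i, c' i = (K.get i).2.2.2.1 + (t i + ∑ y ∈ S, g y i) - u' i := fun i => by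
        rw [k3 i]; ring
      simp only [e, mul_sub, mul_add, Finset.sum_sub_distrib, Finset.sum_add_distrib,
        ← Finset.mul_sum]
      linarith
  | @tval Γ w V A D ih =>
    intro S ρ v hc ho hS hv
    obtain ⟨V', e, h⟩ := ih S ρ v hc ho hS hv
    have hcl : V'.Closed := by
      simp only [msubT, Tm.val.injEq] at e
      exact e ▸ closed_msubV (fun y hy => hc y (by simpa [fvT] using hy))
    rw [e]
    exact ⟨_, 0, _, .val V', DMatch_cons.2 ⟨V', _, [], 0, rfl, rfl, hcl, h,
      DMatch_nil.2 ⟨rfl, rfl⟩⟩, by ring⟩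
  | @bang V I hI f ih =>
    intro S ρ v hc ho hS hv
    choose g eg hg using fun y => IRel_flatten (fun k : ℚ × Ctx × ℚ × ATy => k.1)
      (fun k => k.2.1 y) I (hv y)
    refine ⟨msubV ρ V, by rw [msubT], ?_⟩
    have := IRel_bang (V := msubV ρ V) (fun k : ℚ × Ctx × ℚ × ATy => k.1) (fun k => k.2.2.2) I
      (fun i => (I.get i).2.2.1 + ∑ y ∈ S, g y i) ?_
    · convert this using 1
      simp only [eg]
      rw [Finset.sum_comm, sum_map_get]
      simp only [mul_add, Finset.sum_add_distrib, ← Finset.mul_sum]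
    · intro i
      have hS' : ∀ y, y ∉ S → (I.get i).2.1 y = [] := by
        intro y hy
        have := hS y hy
        rw [List.flatten_eq_nil_iff] at this
        exact List.map_eq_nil_iff.1 (this _ (List.mem_map_of_mem (List.get_mem I i)))
      obtain ⟨V', e, h⟩ := ih i S ρ (fun y => g y i) hc ho hS' (fun y => hg y i)
      simp only [msubT, Tm.val.injEq] at e
      rw [e]; exact h

/-! ### Linear operations on multidistributions -/

def wsum (f : Tm → ℚ) (m : MDist) : ℚ := (m.map fun p => p.1 * f p.2).sum

def mbind (F : Tm → MDist) (m : MDist) : MDist := (m.map fun p => scaleM p.1 (F p.2)).sum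

def valpart (m : MDist) : MDist := m.filter fun p => p.2.isVal = true

theorem scaleM_zero' (q : ℚ) : scaleM q 0 = 0 := by simp [scaleM]

theorem scaleM_add (q : ℚ) (m n : MDist) : scaleM q (m + n) = scaleM q m + scaleM q n := by
  simp [scaleM]

theorem scaleM_one (m : MDist) : scaleM 1 m = m := by simp [scaleM]

theorem scaleM_scaleM (q r : ℚ) (m : MDist) : scaleM q (scaleM r m) = scaleM (q * r) m := by
  simp [scaleM, mul_assoc]

theorem scaleM_mono (q : ℚ) {m n : MDist} (h : m ≤ n) : scaleM q m ≤ scaleM q n :=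
  Multiset.map_le_map h

theorem mbind_zero (F : Tm → MDist) : mbind F 0 = 0 := by simp [mbind]

theorem mbind_add (F : Tm → MDist) (m n : MDist) : mbind F (m + n) = mbind F m + mbind F n := by
  simp [mbind]

theorem mbind_cons (F : Tm → MDist) (a : ℚ × Tm) (m : MDist) :
    mbind F (a ::ₘ m) = scaleM a.1 (F a.2) + mbind F m := by
  simp [mbind]

theorem mbind_scale (F : Tm → MDist) (q : ℚ) (m : MDist) :
    mbind F (scaleM q m) = scaleM q (mbind F m) := by
  induction m using Multiset.induction_on with
  | empty => simp [mbind, scaleM]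
  | cons a m ih =>
    have : scaleM q (a ::ₘ m) = (q * a.1, a.2) ::ₘ scaleM q m := by simp [scaleM]
    rw [this, mbind_cons, mbind_cons, scaleM_add, ih, scaleM_scaleM]

theorem mbind_mbind (F G : Tm → MDist) (m : MDist) :
    mbind G (mbind F m) = mbind (fun t => mbind G (F t)) m := by
  induction m using Multiset.induction_on with
  | empty => simp [mbind]
  | cons a m ih => rw [mbind_cons, mbind_cons, mbind_add, ih, mbind_scale]

theorem mbind_mono {F : Tm → MDist} {m n : MDist} (h : m ≤ n) : mbind F m ≤ mbind F n := by
  obtain ⟨r, rfl⟩ := Multiset.le_iff_exists_add.1 h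
  rw [mbind_add]
  exact Multiset.le_add_right _ _

theorem mbind_mono_right {F G : Tm → MDist} {m : MDist} (h : ∀ a ∈ m, F a.2 ≤ G a.2) :
    mbind F m ≤ mbind G m := by
  induction m using Multiset.induction_on with
  | empty => simp [mbind]
  | cons a m ih =>
    rw [mbind_cons, mbind_cons]
    exact add_le_add (scaleM_mono _ (h a (Multiset.mem_cons_self _ _)))
      (ih fun b hb => h b (Multiset.mem_cons_of_mem hb))

theorem mbind_pure (m : MDist) : mbind (fun t => {(1, t)}) m = m := by
  induction m using Multiset.induction_on with
  | empty => simp [mbind]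
  | cons a m ih => rw [mbind_cons, ih]; simp [scaleM]

theorem wsum_add (f : Tm → ℚ) (m n : MDist) : wsum f (m + n) = wsum f m + wsum f n := by
  simp [wsum]

theorem wsum_cons (f : Tm → ℚ) (a : ℚ × Tm) (m : MDist) :
    wsum f (a ::ₘ m) = a.1 * f a.2 + wsum f m := by
  simp [wsum]

theorem wsum_scale (f : Tm → ℚ) (q : ℚ) (m : MDist) : wsum f (scaleM q m) = q * wsum f m := by
  simp [wsum, scaleM, mul_assoc, Multiset.sum_map_mul_left]

theorem wsum_mbind (f : Tm → ℚ) (F : Tm → MDist) (m : MDist) :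
    wsum f (mbind F m) = wsum (fun t => wsum f (F t)) m := by
  induction m using Multiset.induction_on with
  | empty => simp [mbind, wsum]
  | cons a m ih => rw [mbind_cons, wsum_cons, wsum_add, ih, wsum_scale]

theorem wsum_fadd (f g : Tm → ℚ) (m : MDist) :
    wsum (fun t => f t + g t) m = wsum f m + wsum g m := by
  simp [wsum, mul_add, Multiset.sum_map_add]

theorem wsum_fsub (f g : Tm → ℚ) (m : MDist) :
    wsum (fun t => f t - g t) m = wsum f m - wsum g m := by
  simp [wsum, mul_sub, Multiset.sum_map_sub]

def NN (m : MDist) : Prop := ∀ a ∈ m, 0 ≤ a.1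

theorem wsum_fmono {f g : Tm → ℚ} {m : MDist} (hm : NN m) (h : ∀ a ∈ m, f a.2 ≤ g a.2) :
    wsum f m ≤ wsum g m := by
  refine Multiset.sum_map_le_sum_map _ _ fun a ha => ?_
  exact mul_le_mul_of_nonneg_left (h a ha) (hm a ha)

theorem wsum_nonneg {f : Tm → ℚ} {m : MDist} (hm : NN m) (h : ∀ t, 0 ≤ f t) :
    0 ≤ wsum f m := by
  refine Multiset.sum_nonneg fun a ha => ?_
  obtain ⟨b, hb, rfl⟩ := Multiset.mem_map.1 ha
  exact mul_nonneg (hm b hb) (h _)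

theorem wsum_mono {f : Tm → ℚ} {m n : MDist} (hn : NN n) (h : ∀ t, 0 ≤ f t) (hmn : m ≤ n) :
    wsum f m ≤ wsum f n := by
  obtain ⟨r, rfl⟩ := Multiset.le_iff_exists_add.1 hmn
  rw [wsum_add]
  have := wsum_nonneg (m := r) (fun a ha => hn a (Multiset.mem_add.2 (Or.inr ha))) h
  linarith

theorem NN.mbind {F : Tm → MDist} {m : MDist} (hm : NN m) (hF : ∀ t, NN (F t)) :
    NN (mbind F m) := by
  induction m using Multiset.induction_on with
  | empty => intro a ha; simp [CbV.mbind] at ha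
  | cons b m ih =>
    intro a ha
    rw [mbind_cons, Multiset.mem_add] at ha
    rcases ha with ha | ha
    · obtain ⟨c, hc, rfl⟩ := Multiset.mem_map.1 ha
      exact mul_nonneg (hm b (Multiset.mem_cons_self _ _)) (hF _ c hc)
    · exact ih (fun c hc => hm c (Multiset.mem_cons_of_mem hc)) a ha

theorem valpart_scale (q : ℚ) (m : MDist) : valpart (scaleM q m) = scaleM q (valpart m) := by
  simp [valpart, scaleM, Multiset.filter_map]

theorem valpart_add (m n : MDist) : valpart (m + n) = valpart m + valpart n := by
  simp [valpart]

theorem valpart_mono {m n : MDist} (h : m ≤ n) : valpart m ≤ valpart n :=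
  Multiset.filter_le_filter _ h

theorem valpart_le (m : MDist) : valpart m ≤ m := Multiset.filter_le _ _

theorem valpart_idem (m : MDist) : valpart (valpart m) = valpart m := by
  simp [valpart, Multiset.filter_filter]

theorem valpart_mbind (F : Tm → MDist) (m : MDist) :
    valpart (mbind F m) = mbind (fun t => valpart (F t)) m := by
  induction m using Multiset.induction_on with
  | empty => simp [mbind, valpart]
  | cons a m ih => rw [mbind_cons, mbind_cons, valpart_add, ih, valpart_scale]

/-! ### Trajectories -/

theorem traj_zero (M : Tm) : traj M 0 = {(1, M)} := rfl

theorem traj_succ' (M : Tm) (k : ℕ) : traj M (k + 1) = mbind stepF (traj M k) :=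
  Function.iterate_succ_apply' _ _ _

theorem traj_succ (M : Tm) (k : ℕ) : traj M (k + 1) = mbind (fun t => traj t k) (stepF M) := by
  induction k generalizing M with
  | zero =>
    rw [traj_succ', traj_zero]
    simp only [traj_zero, mbind_pure]
    simp [mbind, scaleM]
  | succ k ih =>
    rw [traj_succ', ih, mbind_mbind]
    simp only [traj_succ']

theorem stepF_let {x : ℕ} {N M : Tm} (h : N.isVal = false) :
    stepF (.letin x N M) = (stepF N).map fun p => (p.1, Tm.letin x p.2 M) := by
  cases N with
  | val V => simp [Tm.isVal] at h
  | app V W => rw [stepF]; simp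
  | choice M N => simp [stepF]
  | letin y N M => rw [stepF]; simp

theorem stepF_NN_mass : ∀ M : Tm, NN (stepF M) ∧ wsum (fun _ => 1) (stepF M) = 1
  | .val V => by
    rw [stepF]
    exact ⟨fun a ha => by rw [Multiset.mem_singleton] at ha; simp [ha], by simp [wsum]⟩
  | .app (.lam x M) V => by
    rw [stepF]
    exact ⟨fun a ha => by rw [Multiset.mem_singleton] at ha; simp [ha], by simp [wsum]⟩
  | .app (.var x) V => by
    rw [stepF]
    exact ⟨fun a ha => by rw [Multiset.mem_singleton] at ha; simp [ha], by simp [wsum]⟩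
  | .choice M N => by
    rw [stepF]
    refine ⟨fun a ha => ?_, ?_⟩
    · simp only [Multiset.insert_eq_cons, Multiset.mem_cons, Multiset.mem_singleton] at ha
      rcases ha with rfl | rfl <;> norm_num
    · simp only [wsum, Multiset.insert_eq_cons, Multiset.map_cons, Multiset.map_singleton,
        Multiset.sum_cons, Multiset.sum_singleton]
      norm_num
  | .letin x N M => by
    by_cases h : N.isVal = true
    · cases N <;> simp [Tm.isVal] at h
      rw [stepF]
      exact ⟨fun a ha => by rw [Multiset.mem_singleton] at ha; simp [ha], by simp [wsum]⟩
    · simp only [Bool.not_eq_true] at h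
      obtain ⟨h1, h2⟩ := stepF_NN_mass N
      rw [stepF_let h]
      refine ⟨fun a ha => ?_, ?_⟩
      · obtain ⟨c, hc, rfl⟩ := Multiset.mem_map.1 ha
        exact h1 c hc
      · refine Eq.trans ?_ h2; simp [wsum]

theorem stepF_NN (M : Tm) : NN (stepF M) := (stepF_NN_mass M).1

theorem stepF_mass (M : Tm) : wsum (fun _ => 1) (stepF M) = 1 := (stepF_NN_mass M).2

theorem traj_NN (M : Tm) (k : ℕ) : NN (traj M k) := by
  induction k with
  | zero => intro a ha; rw [traj_zero, Multiset.mem_singleton] at ha; simp [ha]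
  | succ k ih => rw [traj_succ']; exact ih.mbind stepF_NN

theorem normV_eq (m : MDist) : normV m = wsum (fun t => if t.isVal = true then 1 else 0) m := by
  induction m using Multiset.induction_on with
  | empty => simp [normV, wsum]
  | cons a m ih =>
    rw [wsum_cons, ← ih]
    by_cases h : a.2.isVal = true <;> simp [normV, h]

theorem evalP_zero {M : Tm} (h : M.isVal = false) : evalP 0 M = 0 := by
  rw [evalP, normV_eq, traj_zero]; simp [wsum, h]

theorem evalP_succ (M : Tm) (k : ℕ) : evalP (k + 1) M = wsum (evalP k) (stepF M) := by
  have : evalP k = fun t => wsum (fun t => if t.isVal = true then 1 else 0) (traj t k) := by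
    funext t; rw [evalP, normV_eq]
  rw [this, ← wsum_mbind, evalP, normV_eq, traj_succ]

theorem evalP_le (M : Tm) (k : ℕ) : evalP k M ≤ 1 := by
  induction k generalizing M with
  | zero =>
    rw [evalP, normV_eq, traj_zero]
    simp only [wsum, Multiset.map_singleton, Multiset.sum_singleton]
    split_ifs <;> norm_num
  | succ k ih =>
    rw [evalP_succ, ← stepF_mass M]
    exact wsum_fmono (stepF_NN M) fun a _ => ih a.2

theorem etime_succ' (M : Tm) (k : ℕ) : etime (k + 1) M = etime k M + (1 - evalP k M) := by
  rw [etime, Finset.sum_range_succ, etime]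

theorem etime_mono (M : Tm) : Monotone fun k => etime k M := by
  refine monotone_nat_of_le_succ fun k => ?_
  have := evalP_le M k
  have := etime_succ' M k
  linarith

theorem etime_nonneg (k : ℕ) (M : Tm) : 0 ≤ etime k M := by
  have := etime_mono M (Nat.zero_le k)
  simpa [etime] using this

theorem etime_succ {M : Tm} (h : M.isVal = false) (k : ℕ) :
    etime (k + 1) M = 1 + wsum (etime k) (stepF M) := by
  induction k with
  | zero =>
    have : etime 0 = fun _ => 0 := by funext t; simp [etime]
    rw [etime_succ', evalP_zero h, this]
    simp [wsum]
  | succ k ih =>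
    have : etime (k + 1) = fun t => etime k t + (1 - evalP k t) := by
      funext t; exact etime_succ' t k
    rw [etime_succ', ih, this, wsum_fadd, wsum_fsub, stepF_mass, evalP_succ]
    ring

theorem valpart_step (m : MDist) : valpart m ≤ valpart (mbind stepF m) := by
  have h : mbind stepF (valpart m) = valpart m := by
    induction m using Multiset.induction_on with
    | empty => simp [valpart, mbind]
    | cons a m ih =>
      obtain ⟨p, t⟩ := a
      cases t with
      | val V =>
        have : valpart ((p, .val V) ::ₘ m) = (p, .val V) ::ₘ valpart m := by
          exact Multiset.filter_cons_of_pos _ rfl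
        rw [this, mbind_cons, ih]
        simp [stepF, scaleM]
      | app V W =>
        have : valpart ((p, .app V W) ::ₘ m) = valpart m :=
          Multiset.filter_cons_of_neg _ (by simp [Tm.isVal])
        rw [this, ih]
      | choice V W =>
        have : valpart ((p, .choice V W) ::ₘ m) = valpart m :=
          Multiset.filter_cons_of_neg _ (by simp [Tm.isVal])
        rw [this, ih]
      | letin x V W =>
        have : valpart ((p, .letin x V W) ::ₘ m) = valpart m :=
          Multiset.filter_cons_of_neg _ (by simp [Tm.isVal])
        rw [this, ih]
  calc valpart m = valpart (mbind stepF (valpart m)) := by rw [h, valpart_idem]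
    _ ≤ _ := valpart_mono (mbind_mono (valpart_le m))

theorem valtraj_mono (M : Tm) : Monotone fun k => valpart (traj M k) := by
  refine monotone_nat_of_le_succ fun k => ?_
  rw [traj_succ']
  exact valpart_step _

theorem traj_val (V : Val) (k : ℕ) : traj (.val V) k = {(1, .val V)} := by
  induction k with
  | zero => rfl
  | succ k ih => rw [traj_succ', ih]; simp [mbind, scaleM, stepF]

theorem etime_val (V : Val) (k : ℕ) : etime k (.val V) = 0 := by
  have : ∀ k, evalP k (.val V) = 1 := by
    intro k; rw [evalP, normV_eq, traj_val]; simp [wsum, Tm.isVal]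
  simp [etime, this]

/-! ### The `let` decomposition -/

def bodyD (x : ℕ) (M : Tm) (k : ℕ) : Tm → MDist
  | .val V => valpart (traj (substT M x V) k)
  | _ => 0

def bodyC (x : ℕ) (M : Tm) (k : ℕ) : Tm → ℚ
  | .val V => etime k (substT M x V)
  | _ => 0

theorem bodyD_nv {x : ℕ} {M : Tm} {k : ℕ} {N : Tm} (h : N.isVal = false) :
    bodyD x M k N = 0 := by
  cases N <;> simp_all [bodyD, Tm.isVal]

theorem bodyC_nv {x : ℕ} {M : Tm} {k : ℕ} {N : Tm} (h : N.isVal = false) :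
    bodyC x M k N = 0 := by
  cases N <;> simp_all [bodyC, Tm.isVal]

theorem bodyC_nonneg (x : ℕ) (M : Tm) (k : ℕ) (N : Tm) : 0 ≤ bodyC x M k N := by
  cases N <;> simp [bodyC, etime_nonneg]

theorem mbind_single (F : Tm → MDist) (t : Tm) : mbind F {(1, t)} = F t := by
  simp [mbind, scaleM]

theorem wsum_single (f : Tm → ℚ) (t : Tm) : wsum f {(1, t)} = f t := by
  simp [wsum]

theorem let_traj (x : ℕ) (M : Tm) (k K : ℕ) : ∀ N : Tm,
    mbind (bodyD x M k) (traj N K) ≤ valpart (traj (.letin x N M) (K + 1 + k)) ∧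
    etime K N + 1 + wsum (bodyC x M k) (traj N K) ≤ etime (K + 1 + k) (.letin x N M) := by
  have hval : ∀ (K : ℕ) (V : Val),
      mbind (bodyD x M k) (traj (.val V) K) ≤
        valpart (traj (.letin x (.val V) M) (K + 1 + k)) ∧
      etime K (.val V) + 1 + wsum (bodyC x M k) (traj (.val V) K) ≤
        etime (K + 1 + k) (.letin x (.val V) M) := by
    intro K V
    rw [traj_val, etime_val, mbind_single, wsum_single, add_right_comm K 1 k, traj_succ,
      etime_succ rfl, stepF, mbind_single, wsum_single]
    constructor
    · exact valtraj_mono _ (Nat.le_add_left k K)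
    · have : etime k (substT M x V) ≤ etime (K + k) (substT M x V) :=
        etime_mono _ (Nat.le_add_left k K)
      simp only [bodyC]
      linarith
  induction K with
  | zero =>
    intro N
    by_cases h : N.isVal = true
    · cases N <;> simp [Tm.isVal] at h
      exact hval 0 _
    · simp only [Bool.not_eq_true] at h
      rw [traj_zero, mbind_single, wsum_single, bodyD_nv h, bodyC_nv h, zero_add,
        add_comm 1 k, etime_succ rfl]
      refine ⟨Multiset.zero_le _, ?_⟩
      have := wsum_nonneg (stepF_NN (.letin x N M)) (etime_nonneg k)
      simp only [etime, Finset.range_zero, Finset.sum_empty] at this ⊢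
      linarith
  | succ K ih =>
    intro N
    by_cases h : N.isVal = true
    · cases N <;> simp [Tm.isVal] at h
      exact hval _ _
    · simp only [Bool.not_eq_true] at h
      have e : K + 1 + 1 + k = (K + 1 + k) + 1 := by ring
      rw [e, traj_succ, traj_succ, etime_succ h, etime_succ rfl, stepF_let h, mbind_mbind,
        wsum_mbind]
      have hD : mbind (fun t => traj t (K + 1 + k))
          ((stepF N).map fun p => (p.1, Tm.letin x p.2 M)) =
          mbind (fun t => traj (.letin x t M) (K + 1 + k)) (stepF N) := by
        simp [mbind]
      have hC : wsum (etime (K + 1 + k))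
          ((stepF N).map fun p => (p.1, Tm.letin x p.2 M)) =
          wsum (fun t => etime (K + 1 + k) (.letin x t M)) (stepF N) := by
        simp [wsum]
      rw [hD, hC, valpart_mbind]
      refine ⟨mbind_mono_right fun a _ => (ih a.2).1, ?_⟩
      have := wsum_fmono (f := fun t => etime K t + 1 + wsum (bodyC x M k) (traj t K))
        (g := fun t => etime (K + 1 + k) (.letin x t M)) (stepF_NN N) fun a _ => (ih a.2).2
      rw [wsum_fadd, wsum_fadd, stepF_mass] at this
      linarith

/-! ### From big-step evaluation to trajectories -/

def lm (l : List (ℚ × Val)) : MDist := ↑(l.map fun p => (p.1, Tm.val p.2))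

theorem lm_append (l l' : List (ℚ × Val)) : lm (l ++ l') = lm l + lm l' := by simp [lm]

theorem lm_scale (q : ℚ) (l : List (ℚ × Val)) : lm (scaleL q l) = scaleM q (lm l) := by
  simp [lm, scaleL, scaleM, Function.comp_def]

theorem lm_flatten {n : ℕ} (l : Fin n → List (ℚ × Val)) :
    lm (List.ofFn l).flatten = ∑ i, lm (l i) := by
  induction n with
  | zero => simp [lm]
  | succ n ih => rw [List.ofFn_succ, List.flatten_cons, lm_append, ih, Fin.sum_univ_succ]

theorem lm_cons (p : ℚ) (V : Val) (l : List (ℚ × Val)) :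
    lm ((p, V) :: l) = (p, .val V) ::ₘ lm l := by simp [lm]

theorem mbind_lm (F : Tm → MDist) {n : ℕ} (p : Fin n → ℚ) (V : Fin n → Val) :
    mbind F (lm (List.ofFn fun i => (p i, V i))) = ∑ i, scaleM (p i) (F (.val (V i))) := by
  induction n with
  | zero => simp [lm, mbind]
  | succ n ih => rw [List.ofFn_succ, lm_cons, mbind_cons, ih, Fin.sum_univ_succ]

theorem wsum_lm (f : Tm → ℚ) {n : ℕ} (p : Fin n → ℚ) (V : Fin n → Val) :
    wsum f (lm (List.ofFn fun i => (p i, V i))) = ∑ i, p i * f (.val (V i)) := by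
  induction n with
  | zero => simp [lm, wsum]
  | succ n ih => rw [List.ofFn_succ, lm_cons, wsum_cons, ih, Fin.sum_univ_succ]

theorem Big.sound {M : Tm} {l : List (ℚ × Val)} {c : ℚ} (h : Big M l c) :
    ∃ k, lm l ≤ valpart (traj M k) ∧ c ≤ etime k M := by
  induction h with
  | zero M => exact ⟨0, by simp [lm], by simp [etime]⟩
  | val V => exact ⟨0, by simp [lm, traj_val, valpart, Tm.isVal], by simp [etime]⟩
  | @beta x M V l c h ih =>
    obtain ⟨k, h1, h2⟩ := ih
    refine ⟨k + 1, ?_, ?_⟩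
    · rw [traj_succ, stepF, mbind_single]; exact h1
    · rw [etime_succ rfl, stepF, wsum_single]; linarith
  | @choice M N l l' c c' h h' ih ih' =>
    obtain ⟨k, h1, h2⟩ := ih
    obtain ⟨k', h1', h2'⟩ := ih'
    have g1 := h1.trans (valtraj_mono M (le_max_left k k'))
    have g1' := h1'.trans (valtraj_mono N (le_max_right k k'))
    have g2 := h2.trans (etime_mono M (le_max_left k k'))
    have g2' := h2'.trans (etime_mono N (le_max_right k k'))
    have hs : stepF (.choice M N) = (1/2, M) ::ₘ (1/2, N) ::ₘ 0 := by rw [stepF]; rfl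
    refine ⟨max k k' + 1, ?_, ?_⟩
    · rw [traj_succ, hs, mbind_cons, mbind_cons, mbind_zero, add_zero, valpart_add,
        valpart_scale, valpart_scale, lm_append, lm_scale, lm_scale]
      exact add_le_add (scaleM_mono _ g1) (scaleM_mono _ g1')
    · rw [etime_succ rfl, hs, wsum_cons, wsum_cons]
      have : wsum (etime (max k k')) 0 = 0 := by simp [wsum]
      simp only at g2 g2' ⊢
      linarith
  | @letin x N M n p V l c d h hb ih ihb =>
    obtain ⟨K, h1, h2⟩ := ih
    choose ki g1 g2 using ihb
    obtain ⟨k, hk⟩ : ∃ k, ∀ i, ki i ≤ k :=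
      ⟨Finset.univ.sup ki, fun i => Finset.le_sup (Finset.mem_univ i)⟩
    have h1' := h1.trans (valpart_le _)
    obtain ⟨L1, L2⟩ := let_traj x M k K N
    refine ⟨K + 1 + k, ?_, ?_⟩
    · refine le_trans ?_ ((mbind_mono h1').trans L1)
      rw [mbind_lm, lm_flatten]
      refine Finset.sum_le_sum fun i _ => ?_
      rw [lm_scale]
      exact scaleM_mono _ ((g1 i).trans (valtraj_mono _ (hk i)))
    · have hp : ∀ i, 0 ≤ p i := by
        intro i
        refine traj_NN N K (p i, .val (V i)) (Multiset.mem_of_le h1' ?_)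
        rw [lm, Multiset.mem_coe]
        refine List.mem_map.2 ⟨(p i, V i), ?_, rfl⟩
        rw [List.mem_ofFn]
        exact ⟨i, rfl⟩
      have e := wsum_mono (traj_NN N K) (bodyC_nonneg x M k) h1'
      rw [wsum_lm] at e
      have : ∑ i, p i * c i ≤ ∑ i, p i * bodyC x M k (.val (V i)) := by
        refine Finset.sum_le_sum fun i _ => mul_le_mul_of_nonneg_left ?_ (hp i)
        exact (g2 i).trans (etime_mono _ (hk i))
      linarith

theorem DMatch_tight {b : DTy} : ∀ {l : List (ℚ × Val)} {u : ℚ}, Tight b → DMatch b l u →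
    u = 0 ∧ normD b = normV (lm l) := by
  induction b with
  | nil =>
    intro l u _ h
    obtain ⟨rfl, rfl⟩ := DMatch_nil.1 h
    simp [normD, normV, lm]
  | cons a b ih =>
    intro l u ht h
    obtain ⟨p, B⟩ := a
    obtain ⟨V, v, l', u', rfl, rfl, _, hv, hm⟩ := DMatch_cons.1 h
    have hB : B = [] := ht (p, B) (by simp)
    subst hB
    obtain ⟨rfl, e⟩ := ih (fun q hq => ht q (by simp [hq])) hm
    rw [IRel_nil] at hv
    refine ⟨by simp [hv], ?_⟩
    rw [normV_eq, lm_cons, wsum_cons, ← normV_eq, ← e]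
    simp [normD, Tm.isVal]

/-- **Finitary Soundness**: any tight typing `⊢_w M : 𝔟` of a closed term
underapproximates some finite approximant: `‖𝔟‖ ≤ eval_k(M)` and
`w ≤ etime_k(M)` for some `k`. -/
theorem finitary_soundness {M : Tm} (hM : M.Closed) {w : ℚ} {b : DTy}
    (ht : Tight b) (Pi : Deriv emptyCtx w M (.dist b)) :
    ∃ k : ℕ, normD b ≤ evalP k M ∧ w ≤ etime k M := by
  obtain ⟨l, c, u, h1, h2, h3⟩ := sound Pi ∅ Val.var (fun _ => 0)
    (fun y hy => by rw [Tm.Closed] at hM; simp [hM] at hy) (fun y => Or.inr rfl)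
    (fun y _ => rfl) (fun y => IRel_nil.2 rfl)
  rw [msubT_var] at h1
  obtain ⟨k, g1, g2⟩ := h1.sound
  obtain ⟨rfl, e⟩ := DMatch_tight ht h2
  refine ⟨k, ?_, ?_⟩
  · rw [e, evalP, normV_eq, normV_eq]
    refine wsum_mono (traj_NN M k) (fun t => ?_) (g1.trans (valpart_le _))
    split_ifs <;> norm_num
  · simp only [Finset.sum_empty, add_zero] at h3
    linarith

end CbV
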